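/- Let F be a field of characteristic 2 and let φ, ψ be totally singular quadratic forms over F of dimension at most 5. If φ and ψ are Vishik equivalent, then φ and ψ are similar. -/

import Mathlib

/-!
Diagonal quasilinear `p`-forms over a field `F` of characteristic `p`,
following Hoffmann and Zemková. A form of dimension `n` is recorded by its
coefficient tuple `a : ι → F` (for a finite index type `ι`), the form being
`x ↦ ∑ i, a i * (x i)^p`.
-/

universe u

namespace QLF

open scoped BigOperators

/-- Evaluation of the diagonal quasilinear `p`-form with coefficients `a` at `x`. -/
def eval (p : ℕ) {F : Type*} [CommRing F] {ι : Type*} [Fintype ι]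
    (a : ι → F) (x : ι → F) : F :=
  ∑ i, a i * x i ^ p

/-- A form is isotropic if it has a nontrivial zero. -/
def Isotropic (p : ℕ) {F : Type*} [CommRing F] {ι : Type*} [Fintype ι] (a : ι → F) : Prop :=
  ∃ x : ι → F, x ≠ 0 ∧ eval p a x = 0

/-- A form is anisotropic if it has no nontrivial zero. -/
def Anisotropic (p : ℕ) {F : Type*} [CommRing F] {ι : Type*} [Fintype ι] (a : ι → F) : Prop :=
  ¬ Isotropic p a

/-- In characteristic `p`, the zero set of a diagonal quasilinear `p`-form is a
linear subspace. -/
def zeroSubmodule (p : ℕ) [Fact p.Prime] {F : Type*} [Field F] [CharP F p]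
    {ι : Type*} [Fintype ι] (a : ι → F) : Submodule F (ι → F) where
  carrier := {x | eval p a x = 0}
  zero_mem' := by
    have hp : p ≠ 0 := (Fact.out : p.Prime).ne_zero
    simp [eval, zero_pow hp]
  add_mem' := by
    intro x y hx hy
    haveI : ExpChar F p := .prime Fact.out
    have hxy : eval p a (x + y) = eval p a x + eval p a y := by
      simp only [eval, Pi.add_apply]
      rw [← Finset.sum_add_distrib]
      exact Finset.sum_congr rfl fun i _ => by rw [add_pow_char, mul_add]
    simp only [Set.mem_setOf_eq] at *
    rw [hxy, hx, hy, add_zero]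
  smul_mem' := by
    intro c x hx
    simp only [Set.mem_setOf_eq] at *
    have hcx : eval p a (c • x) = c ^ p * eval p a x := by
      simp only [eval, Pi.smul_apply, smul_eq_mul, Finset.mul_sum]
      exact Finset.sum_congr rfl fun i _ => by rw [mul_pow]; ring
    rw [hcx, hx, mul_zero]

/-- The defect `i₀` of a form: the dimension of its zero set. -/
noncomputable def defect (p : ℕ) [Fact p.Prime] {F : Type*} [Field F] [CharP F p]
    {ι : Type*} [Fintype ι] (a : ι → F) : ℕ :=
  Module.finrank F (zeroSubmodule p a)

/-- Isometry of forms: a linear bijection carrying one form into the other. -/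
def Isometric (p : ℕ) {F : Type*} [Field F] {ι κ : Type*} [Fintype ι] [Fintype κ]
    (a : ι → F) (b : κ → F) : Prop :=
  ∃ T : (ι → F) ≃ₗ[F] (κ → F), ∀ x, eval p a x = eval p b (T x)

/-- `a` is a subform of `b`. -/
def Subform (p : ℕ) {F : Type*} [Field F] {ι κ : Type*} [Fintype ι] [Fintype κ]
    (a : ι → F) (b : κ → F) : Prop :=
  ∃ T : (ι → F) →ₗ[F] (κ → F), Function.Injective T ∧ ∀ x, eval p a x = eval p b (T x)

/-- Similarity of forms: `a ≃ c·b` for some scalar `c ≠ 0`. -/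
def Similar (p : ℕ) {F : Type*} [Field F] {ι κ : Type*} [Fintype ι] [Fintype κ]
    (a : ι → F) (b : κ → F) : Prop :=
  ∃ c : F, c ≠ 0 ∧ Isometric p a (fun i => c * b i)

/-- Vishik equivalence: same dimension, and equal defects over every field
extension `E/F`. -/
def VishikEquiv (p : ℕ) [Fact p.Prime] {F : Type u} [Field F] [CharP F p]
    {ι κ : Type*} [Fintype ι] [Fintype κ] (a : ι → F) (b : κ → F) : Prop :=
  Fintype.card ι = Fintype.card κ ∧
    ∀ (E : Type u) [Field E] [CharP E p] (f : F →+* E),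
      defect p (f ∘ a) = defect p (f ∘ b)

/-- Weak Vishik equivalence: same dimension, and equal defects over every field
extension of the shape `E = F(α)` with `αᵖ ∈ F` (this includes `E = F`). -/
def WeakVishikEquiv (p : ℕ) [Fact p.Prime] {F : Type u} [Field F] [CharP F p]
    {ι κ : Type*} [Fintype ι] [Fintype κ] (a : ι → F) (b : κ → F) : Prop :=
  Fintype.card ι = Fintype.card κ ∧
    ∀ (E : Type u) [Field E] [CharP E p] (f : F →+* E) (α : E),
      α ^ p ∈ Set.range ⇑f →
      Subfield.closure (insert α (Set.range ⇑f)) = ⊤ →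
      defect p (f ∘ a) = defect p (f ∘ b)

/-- The set `Fᵖ` of `p`-th powers. -/
def pSet (p : ℕ) (F : Type*) [Field F] : Set F := Set.range fun x : F => x ^ p

/-- The subfield `Fᵖ` of `p`-th powers (in characteristic `p` the set of `p`-th
powers is already a subfield, so the closure adds nothing). -/
def pthSubfield (p : ℕ) (F : Type*) [Field F] : Subfield F :=
  Subfield.closure (pSet p F)

/-- The subfield `Fᵖ(s)` generated by a set `s` over `Fᵖ`. -/
def adjoin (p : ℕ) {F : Type*} [Field F] (s : Set F) : Subfield F :=
  Subfield.closure (pSet p F ∪ s)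

/-- The degree `[N : k]` of a subfield `N` over a subfield `k` (for `k ≤ N`,
the `k`-span of `N` in `F` is `N` itself, so this is the `k`-dimension of `N`). -/
noncomputable def degOver {F : Type*} [Field F] (k : Subfield F) (N : Subfield F) : ℕ :=
  Module.finrank k (Submodule.span k (N : Set F))

/-- The set `D_F(φ)` of values of the form. -/
def values (p : ℕ) {F : Type*} [CommRing F] {ι : Type*} [Fintype ι] (a : ι → F) : Set F :=
  Set.range (eval p a)

/-- The norm field `N_F(φ)`: the subfield generated over `Fᵖ` by all quotients
of nonzero values of `φ`. -/
def normField (p : ℕ) {F : Type*} [Field F] {ι : Type*} [Fintype ι] (a : ι → F) : Subfield F :=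
  adjoin p {z : F | ∃ u ∈ values p a, ∃ v ∈ values p a, u ≠ 0 ∧ v ≠ 0 ∧ z = u / v}

/-- The norm degree `ndeg_F(φ) = [N_F(φ) : Fᵖ]`. -/
noncomputable def ndeg (p : ℕ) {F : Type*} [Field F] {ι : Type*} [Fintype ι] (a : ι → F) : ℕ :=
  degOver (pthSubfield p F) (normField p a)

/-- An anisotropic form is minimal if `ndeg_F(φ) = p^(dim φ - 1)`. -/
def Minimal (p : ℕ) {F : Type*} [Field F] {ι : Type*} [Fintype ι] (a : ι → F) : Prop :=
  Anisotropic p a ∧ ndeg p a = p ^ (Fintype.card ι - 1)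

/-- The quasi-Pfister form `⟪b₁,…,bₙ⟫`: its coefficients are all products
`b₁^{e₁}⋯bₙ^{eₙ}` with `0 ≤ eᵢ ≤ p-1`. -/
def pfister (p : ℕ) {F : Type*} [CommRing F] {n : ℕ} (b : Fin n → F) :
    (Fin n → Fin p) → F :=
  fun e => ∏ i, b i ^ (e i : ℕ)

/-- A form is a quasi-Pfister form if it is isometric to some `⟪b₁,…,bₙ⟫`
with all `bᵢ ∈ F×`. -/
def IsQuasiPfister (p : ℕ) {F : Type*} [Field F] {ι : Type*} [Fintype ι] (a : ι → F) : Prop :=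
  ∃ (n : ℕ) (b : Fin n → F), (∀ i, b i ≠ 0) ∧ Isometric p a (pfister p b)

/-- `a` is a quasi-Pfister neighbor of the form `π`: `c·a ⊆ π` for some `c ≠ 0`
and `p · dim a > dim π`. -/
def IsNeighborOf (p : ℕ) {F : Type*} [Field F] {ι κ : Type*} [Fintype ι] [Fintype κ]
    (a : ι → F) (π : κ → F) : Prop :=
  ∃ c : F, c ≠ 0 ∧ Subform p (fun i => c * a i) π ∧ p * Fintype.card ι > Fintype.card κ

/-- `a` is a quasi-Pfister neighbor (of some quasi-Pfister form). -/
def IsQPNeighbor (p : ℕ) {F : Type*} [Field F] {ι : Type*} [Fintype ι] (a : ι → F) : Prop :=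
  ∃ (n : ℕ) (b : Fin n → F), (∀ i, b i ≠ 0) ∧ IsNeighborOf p a (pfister p b)

/-- `a` is a quasi-Pfister neighbor of codimension one of some anisotropic
quasi-Pfister form: `dim π - dim a = 1`. -/
def IsQPNeighborCodimOne (p : ℕ) {F : Type*} [Field F] {ι : Type*} [Fintype ι]
    (a : ι → F) : Prop :=
  ∃ (n : ℕ) (b : Fin n → F), (∀ i, b i ≠ 0) ∧ Anisotropic p (pfister p b) ∧
    IsNeighborOf p a (pfister p b) ∧ Fintype.card ι + 1 = p ^ n

/-- Tensor product of diagonal forms: coefficients `aᵢ · bⱼ`. -/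
def tensor (p : ℕ) {F : Type*} [CommRing F] {ι κ : Type*}
    (a : ι → F) (b : κ → F) : ι × κ → F :=
  fun ik => a ik.1 * b ik.2

/-- The set `G_F(φ) = {x ∈ F× : xφ ≃ φ} ∪ {0}` of similarity factors. -/
def simFactors (p : ℕ) {F : Type*} [Field F] {ι : Type*} [Fintype ι] (a : ι → F) : Set F :=
  {x | x ≠ 0 ∧ Isometric p (fun i => x * a i) a} ∪ {0}

/-- `b` is the anisotropic part of `a`: `b` is anisotropic and
`a ≃ b ⊥ (m × ⟨0⟩)` for some `m`. -/
def IsAnisotropicPart (p : ℕ) {F : Type*} [Field F] {ι κ : Type*} [Fintype ι] [Fintype κ]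
    (a : ι → F) (b : κ → F) : Prop :=
  Anisotropic p b ∧ ∃ m : ℕ, Isometric p a (Sum.elim b fun _ : Fin m => (0 : F))

/-- `⟪c₁,…,cₘ⟫` is (a representative of) the norm form of `a`:
`N_F(a) = Fᵖ(c₁,…,cₘ)` and `ndeg_F(a) = pᵐ`. -/
def IsNormForm (p : ℕ) {F : Type*} [Field F] {ι : Type*} [Fintype ι] (a : ι → F)
    {m : ℕ} (c : Fin m → F) : Prop :=
  normField p a = adjoin p (Set.range c) ∧ ndeg p a = p ^ m

end QLF

namespace SquareStab

section Stab

open Module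
open IntermediateField hiding algebraMap_mem

variable {K F : Type*} [Field K] [Field F] [Algebra K F]

/-- The elements of `V` that stay in `V` after multiplication by `d`. -/
def stab (V : Submodule K F) (d : F) : Submodule K F :=
  V ⊓ V.comap (LinearMap.mulLeft K d)

theorem mem_stab {V : Submodule K F} {d z : F} : z ∈ stab V d ↔ z ∈ V ∧ d * z ∈ V := by
  simp [stab]

theorem stab_le (V : Submodule K F) (d : F) : stab V d ≤ V := inf_le_left

theorem bot_mul_mem {U : Submodule K F} {r x : F} (hr : r ∈ (⊥ : IntermediateField K F))
    (hx : x ∈ U) : r * x ∈ U := by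
  obtain ⟨k, rfl⟩ := mem_bot.1 hr
  rw [← Algebra.smul_def]
  exact U.smul_mem k hx

theorem exists_add_mul_of_mem_adjoin_insert (hsq : ∀ x : F, x ^ 2 ∈ (⊥ : IntermediateField K F))
    {S : Set F} {b r : F} (hr : r ∈ adjoin K (insert b S)) :
    ∃ α ∈ adjoin K S, ∃ β ∈ adjoin K S, r = α + b * β := by
  have hbot (x : F) : x ^ 2 ∈ adjoin K S := bot_le (a := adjoin K S) (hsq x)
  induction hr using adjoin_induction with
  | mem x hx =>
    rcases hx with rfl | hx
    · exact ⟨0, zero_mem _, 1, one_mem _, by ring⟩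
    · exact ⟨x, subset_adjoin K S hx, 0, zero_mem _, by ring⟩
  | algebraMap k => exact ⟨_, algebraMap_mem _ k, 0, zero_mem _, by ring⟩
  | add x y _ _ hx hy =>
    obtain ⟨α, hα, β, hβ, rfl⟩ := hx
    obtain ⟨γ, hγ, δ, hδ, rfl⟩ := hy
    exact ⟨_, add_mem hα hγ, _, add_mem hβ hδ, by ring⟩
  | mul x y _ _ hx hy =>
    obtain ⟨α, hα, β, hβ, rfl⟩ := hx
    obtain ⟨γ, hγ, δ, hδ, rfl⟩ := hy
    exact ⟨α * γ + b ^ 2 * (β * δ), add_mem (mul_mem hα hγ) (mul_mem (hbot b) (mul_mem hβ hδ)),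
      α * δ + β * γ, add_mem (mul_mem hα hδ) (mul_mem hβ hγ), by ring⟩
  | inv x _ hx =>
    obtain ⟨α, hα, β, hβ, hxe⟩ := hx
    refine ⟨(x ^ 2)⁻¹ * α, mul_mem (inv_mem (hbot x)) hα, (x ^ 2)⁻¹ * β,
      mul_mem (inv_mem (hbot x)) hβ, ?_⟩
    rw [show (x ^ 2)⁻¹ * α + b * ((x ^ 2)⁻¹ * β) = (x ^ 2)⁻¹ * (α + b * β) by ring, ← hxe]
    by_cases h0 : x = 0
    · simp [h0]
    · field_simp

theorem exists_add_mul_of_mem_adjoin_simple (hsq : ∀ x : F, x ^ 2 ∈ (⊥ : IntermediateField K F))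
    {a r : F} (hr : r ∈ K⟮a⟯) :
    ∃ s ∈ (⊥ : IntermediateField K F), ∃ t ∈ (⊥ : IntermediateField K F), r = s + a * t := by
  rw [← adjoin_empty K F]
  refine exists_add_mul_of_mem_adjoin_insert hsq ?_
  simpa using hr

theorem mem_of_add_mul_mem {L : IntermediateField K F} {b s t : F} (hs : s ∈ L) (ht : t ∈ L)
    (ht0 : t ≠ 0) (h : s + b * t ∈ L) : b ∈ L := by
  have : b = (s + b * t - s) / t := by field_simp; ring
  rw [this]
  exact div_mem (sub_mem h hs) ht

theorem adjoin_simple_mul_mem (hsq : ∀ x : F, x ^ 2 ∈ (⊥ : IntermediateField K F))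
    {V : Submodule K F} {d r z : F} (hr : r ∈ K⟮d⟯) (hz : z ∈ stab V d) : r * z ∈ stab V d := by
  obtain ⟨s, hs, t, ht, rfl⟩ := exists_add_mul_of_mem_adjoin_simple hsq hr
  rw [mem_stab] at hz ⊢
  constructor
  · rw [show (s + d * t) * z = s * z + t * (d * z) by ring]
    exact V.add_mem (bot_mul_mem hs hz.1) (bot_mul_mem ht hz.2)
  · rw [show d * ((s + d * t) * z) = s * (d * z) + t * (d ^ 2 * z) by ring]
    exact V.add_mem (bot_mul_mem hs hz.2) (bot_mul_mem ht (bot_mul_mem (hsq d) hz.1))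

theorem eq_zero_of_add_mul_eq_zero {L : IntermediateField K F} {d s t : F} (hd : d ∉ L)
    (hs : s ∈ L) (ht : t ∈ L) (h : s + d * t = 0) : s = 0 ∧ t = 0 := by
  have ht0 : t = 0 := by
    by_contra ht0
    exact hd (mem_of_add_mul_mem hs ht ht0 (h ▸ zero_mem L))
  subst ht0
  simpa using h

theorem two_le_finrank {U : Submodule K F} [FiniteDimensional K U] {d x : F}
    (hd : d ∉ (⊥ : IntermediateField K F)) (hx0 : x ≠ 0) (hx : x ∈ U) (hdx : d * x ∈ U) :
    2 ≤ finrank K U := by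
  have hli : LinearIndependent K ![(⟨x, hx⟩ : U), ⟨d * x, hdx⟩] := by
    rw [LinearIndependent.pair_iff]
    intro s t h
    have h' : (algebraMap K F s + d * algebraMap K F t) * x = 0 := by
      have := congrArg Subtype.val h
      simp only [Submodule.coe_add, Submodule.coe_smul, Algebra.smul_def,
        Submodule.coe_zero] at this
      linear_combination this
    have := eq_zero_of_add_mul_eq_zero hd (algebraMap_mem _ s) (algebraMap_mem _ t)
      ((mul_eq_zero.1 h').resolve_right hx0)
    simpa using this
  simpa using hli.fintype_card_le_finrank

theorem four_le_finrank {U : Submodule K F} [FiniteDimensional K U] {d x y : F}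
    (hd : d ∉ (⊥ : IntermediateField K F)) (hx0 : x ≠ 0) (hx : x ∈ U) (hdx : d * x ∈ U)
    (hy : y ∈ U) (hdy : d * y ∈ U) (hxy : ∀ r ∈ K⟮d⟯, y ≠ r * x) :
    4 ≤ finrank K U := by
  have hli : LinearIndependent K ![(⟨x, hx⟩ : U), ⟨d * x, hdx⟩, ⟨y, hy⟩, ⟨d * y, hdy⟩] := by
    rw [Fintype.linearIndependent_iff]
    intro g h
    have h' : (algebraMap K F (g 0) + d * algebraMap K F (g 1)) * x +
        (algebraMap K F (g 2) + d * algebraMap K F (g 3)) * y = 0 := by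
      have := congrArg Subtype.val h
      simp only [Fin.sum_univ_four, Submodule.coe_add, Submodule.coe_smul, Algebra.smul_def,
        Submodule.coe_zero] at this
      simp at this
      linear_combination this
    have hmem (s t : K) : algebraMap K F s + d * algebraMap K F t ∈ K⟮d⟯ :=
      add_mem (algebraMap_mem _ s) (mul_mem (mem_adjoin_simple_self K d) (algebraMap_mem _ t))
    have h23 : algebraMap K F (g 2) + d * algebraMap K F (g 3) = 0 := by
      by_contra hne
      refine hxy (-(algebraMap K F (g 0) + d * algebraMap K F (g 1)) /
        (algebraMap K F (g 2) + d * algebraMap K F (g 3)))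
        (div_mem (neg_mem (hmem _ _)) (hmem _ _)) ?_
      field_simp
      linear_combination h'
    rw [h23, zero_mul, add_zero] at h'
    have h01 := (mul_eq_zero.1 h').resolve_right hx0
    have e01 := eq_zero_of_add_mul_eq_zero hd (algebraMap_mem _ _) (algebraMap_mem _ _) h01
    have e23 := eq_zero_of_add_mul_eq_zero hd (algebraMap_mem _ _) (algebraMap_mem _ _) h23
    simp only [map_eq_zero] at e01 e23
    intro i
    fin_cases i
    exacts [e01.1, e01.2, e23.1, e23.2]
  simpa using hli.fintype_card_le_finrank

instance (V : Submodule K F) [FiniteDimensional K V] (d : F) : FiniteDimensional K (stab V d) :=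
  Submodule.finiteDimensional_of_le (stab_le V d)

theorem four_le_finrank_stab (hsq : ∀ x : F, x ^ 2 ∈ (⊥ : IntermediateField K F))
    {V : Submodule K F} [FiniteDimensional K V] {d x y : F}
    (hd : d ∉ (⊥ : IntermediateField K F)) (hx0 : x ≠ 0) (hx : x ∈ stab V d) (hy : y ∈ stab V d)
    (hxy : ∀ r ∈ K⟮d⟯, y ≠ r * x) : 4 ≤ finrank K (stab V d) :=
  four_le_finrank hd hx0 hx (adjoin_simple_mul_mem hsq (mem_adjoin_simple_self K d) hx)
    hy (adjoin_simple_mul_mem hsq (mem_adjoin_simple_self K d) hy) hxy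

theorem exists_mul_of_mem_stab (hsq : ∀ x : F, x ^ 2 ∈ (⊥ : IntermediateField K F))
    {W : Submodule K F} [FiniteDimensional K W] {d x y : F}
    (hd : d ∉ (⊥ : IntermediateField K F)) (hW : finrank K (stab W d) ≤ 3) (hx0 : x ≠ 0)
    (hx : x ∈ stab W d) (hy : y ∈ stab W d) : ∃ r ∈ K⟮d⟯, y = r * x := by
  by_contra! h
  have := four_le_finrank_stab hsq hd hx0 hx hy h
  omega

theorem exists_mem_of_stab_ne_bot {V : Submodule K F} {d : F} (h : stab V d ≠ ⊥) :
    ∃ x, x ≠ 0 ∧ x ∈ stab V d := by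
  obtain ⟨x, hx, h0⟩ := Submodule.exists_mem_ne_zero_of_ne_bot h
  exact ⟨x, h0, hx⟩

theorem exists_mem_stab_inf (hsq : ∀ x : F, x ^ 2 ∈ (⊥ : IntermediateField K F))
    {W : Submodule K F} [FiniteDimensional K W] (hdim : finrank K W ≤ 5)
    (hW : ∀ d ∉ (⊥ : IntermediateField K F), finrank K (stab W d) ≤ 3) {a b : F}
    (ha : a ∉ (⊥ : IntermediateField K F)) (hb : b ∉ K⟮a⟯)
    (hWa : stab W a ≠ ⊥) (hWb : stab W b ≠ ⊥) (hWab : stab W (a * b) ≠ ⊥) :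
    ∃ w, w ≠ 0 ∧ w ∈ stab W a ∧ w ∈ stab W b := by
  by_contra! hdisj
  have haa := mem_adjoin_simple_self K a
  have hb' : b ∉ (⊥ : IntermediateField K F) := fun h => hb (bot_le (a := K⟮a⟯) h)
  have ha0 : a ≠ 0 := fun h => ha (h ▸ zero_mem _)
  have hb0 : b ≠ 0 := fun h => hb' (h ▸ zero_mem _)
  have hab : a * b ∉ (⊥ : IntermediateField K F) := fun h => hb (by
    have := div_mem (bot_le (a := K⟮a⟯) h) haa
    rwa [mul_div_cancel_left₀ _ ha0] at this)
  have two {d : F} (hd : d ∉ (⊥ : IntermediateField K F)) (h : stab W d ≠ ⊥) :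
      2 ≤ finrank K (stab W d) := by
    obtain ⟨x, hx0, hx⟩ := exists_mem_of_stab_ne_bot h
    exact two_le_finrank hd hx0 hx (adjoin_simple_mul_mem hsq (mem_adjoin_simple_self K d) hx)
  obtain ⟨s, hs0, hsab, hs⟩ :
      ∃ s, s ≠ 0 ∧ s ∈ stab W (a * b) ∧ s ∈ stab W a ⊔ stab W b := by
    by_contra! hcon
    have h1 : stab W a ⊓ stab W b = ⊥ := by
      rw [Submodule.eq_bot_iff]
      intro w hw
      by_contra h0
      exact hdisj w h0 hw.1 hw.2
    have h2 : (stab W a ⊔ stab W b) ⊓ stab W (a * b) = ⊥ := by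
      rw [Submodule.eq_bot_iff]
      intro w hw
      by_contra h0
      exact hcon w h0 hw.2 hw.1
    have e1 := Submodule.finrank_sup_add_finrank_inf_eq (stab W a) (stab W b)
    have e2 := Submodule.finrank_sup_add_finrank_inf_eq (stab W a ⊔ stab W b) (stab W (a * b))
    rw [h1, finrank_bot] at e1
    rw [h2, finrank_bot] at e2
    have e3 := Submodule.finrank_mono (sup_le (sup_le (stab_le W a) (stab_le W b))
      (stab_le W (a * b)))
    have := two ha hWa
    have := two hb' hWb
    have := two hab hWab
    omega
  obtain ⟨p, hp, q, hq, rfl⟩ := Submodule.mem_sup.1 hs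
  have hx := adjoin_simple_mul_mem hsq haa hp
  have hy := adjoin_simple_mul_mem hsq (mem_adjoin_simple_self K b) hq
  set x := a * p with hxdef
  set y := b * q with hydef
  have hu : b * x + a * y ∈ W := by
    have := (mem_stab.1 hsab).2
    rwa [show a * b * (p + q) = b * x + a * y by rw [hxdef, hydef]; ring] at this
  have hx0 : x ≠ 0 := by
    intro h0
    have hy0 : y ≠ 0 := by
      rintro h1
      rw [hxdef, mul_eq_zero, or_iff_right ha0] at h0
      rw [hydef, mul_eq_zero, or_iff_right hb0] at h1
      simp [h0, h1] at hs0
    rw [h0, mul_zero, zero_add] at hu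
    exact hdisj y hy0 (mem_stab.2 ⟨(mem_stab.1 hy).1, hu⟩) hy
  have hy0 : y ≠ 0 := by
    intro h0
    rw [h0, mul_zero, add_zero] at hu
    exact hdisj x hx0 hx (mem_stab.2 ⟨(mem_stab.1 hx).1, hu⟩)
  -- `x` and `y` are linearly independent over `K⟮b, a⟯`
  have hindep : ∀ μ ∈ K⟮b, a⟯, y ≠ μ * x := by
    intro μ hμ hyμ
    obtain ⟨α, hα, β, hβ, rfl⟩ := exists_add_mul_of_mem_adjoin_insert hsq hμ
    have hαx := adjoin_simple_mul_mem hsq hα hx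
    have hβx := adjoin_simple_mul_mem hsq hβ hx
    have hbβ : b * (β * x) ∈ W := by
      have := W.sub_mem (mem_stab.1 hy).1 (mem_stab.1 hαx).1
      rwa [hyμ, show (α + b * β) * x - α * x = b * (β * x) by ring] at this
    have hβ0 : β * x = 0 := by
      by_contra h0
      exact hdisj _ h0 hβx (mem_stab.2 ⟨(mem_stab.1 hβx).1, hbβ⟩)
    have : y = α * x := by rw [hyμ]; linear_combination b * hβ0
    exact hdisj y hy0 (this ▸ hαx) hy
  have hd : y / x ∉ (⊥ : IntermediateField K F) := fun h =>
    hindep (y / x) (bot_le (a := K⟮b, a⟯) h) (by field_simp)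
  have hdx : x ∈ stab W (y / x) := mem_stab.2 ⟨(mem_stab.1 hx).1, by
    rw [div_mul_cancel₀ _ hx0]; exact (mem_stab.1 hy).1⟩
  have hdu : b * x + a * y ∈ stab W (y / x) := mem_stab.2 ⟨hu, by
    rw [show y / x * (b * x + a * y) = b * y + (y / x) ^ 2 * (a * x) by field_simp]
    exact W.add_mem (mem_stab.1 hy).2 (bot_mul_mem (hsq _) (mem_stab.1 hx).2)⟩
  obtain ⟨r, hr, hur⟩ := exists_mul_of_mem_stab hsq hd (hW _ hd) hx0 hdx hdu
  obtain ⟨s, hs', t, ht, rfl⟩ := exists_add_mul_of_mem_adjoin_simple hsq hr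
  have hrel : (b - s) * x = (t - a) * y := by
    have : (s + y / x * t) * x = s * x + t * y := by field_simp
    rw [this] at hur
    linear_combination hur
  have hta : t - a ≠ 0 := fun h => ha (by rwa [← sub_eq_zero.1 h])
  have hbM : b ∈ K⟮b, a⟯ := subset_adjoin K _ (by simp)
  have haM : a ∈ K⟮b, a⟯ := subset_adjoin K _ (by simp)
  refine hindep ((b - s) / (t - a)) (div_mem (sub_mem hbM (bot_le (a := K⟮b, a⟯) hs'))
    (sub_mem (bot_le (a := K⟮b, a⟯) ht) haM)) ?_
  rw [div_mul_eq_mul_div, hrel]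
  field_simp

theorem exists_mul_mem_of_finrank_stab_le (hsq : ∀ x : F, x ^ 2 ∈ (⊥ : IntermediateField K F))
    {V W : Submodule K F} [FiniteDimensional K V] [FiniteDimensional K W]
    (hdim : finrank K W ≤ 5)
    (hV : ∀ d ∉ (⊥ : IntermediateField K F), finrank K (stab V d) ≤ 3)
    (hW : ∀ d ∉ (⊥ : IntermediateField K F), finrank K (stab W d) ≤ 3)
    (h1 : 1 ∈ V) (hWV : ∀ d, stab V d ≠ ⊥ → stab W d ≠ ⊥) :
    ∃ z, z ≠ 0 ∧ ∀ c ∈ V, c * z ∈ W := by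
  have hmem {c : F} (hc : c ∈ V) : stab W c ≠ ⊥ :=
    hWV c fun h => one_ne_zero (((Submodule.eq_bot_iff _).1 h) (1 : F)
      (mem_stab.2 ⟨h1, by simpa using hc⟩))
  have hmul {a b : F} (ha : a ∈ V) (hb : b ∈ V) (hb0 : b ≠ 0) : stab W (a * b) ≠ ⊥ :=
    hWV _ fun h => hb0 (((Submodule.eq_bot_iff _).1 h) b
      (mem_stab.2 ⟨hb, by
        rw [show a * b * b = b ^ 2 * a by ring]; exact bot_mul_mem (hsq b) ha⟩))
  have meet {a b : F} (haV : a ∈ V) (hbV : b ∈ V) (ha : a ∉ (⊥ : IntermediateField K F))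
      (hb : b ∉ K⟮a⟯) : ∃ w, w ≠ 0 ∧ w ∈ stab W a ∧ w ∈ stab W b :=
    exists_mem_stab_inf hsq hdim hW ha hb (hmem haV) (hmem hbV)
      (hmul haV hbV (fun h => hb (h ▸ zero_mem _)))
  by_cases hbot : ∀ c ∈ V, c ∈ (⊥ : IntermediateField K F)
  · obtain ⟨z, hz0, hz⟩ := exists_mem_of_stab_ne_bot (hmem h1)
    exact ⟨z, hz0, fun c hc => bot_mul_mem (hbot c hc) (mem_stab.1 hz).1⟩
  push Not at hbot
  obtain ⟨a, haV, ha⟩ := hbot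
  by_cases hKa : ∀ c ∈ V, c ∈ K⟮a⟯
  · obtain ⟨z, hz0, hz⟩ := exists_mem_of_stab_ne_bot (hmem haV)
    exact ⟨z, hz0, fun c hc => (mem_stab.1 (adjoin_simple_mul_mem hsq (hKa c hc) hz)).1⟩
  push Not at hKa
  obtain ⟨b, hbV, hb⟩ := hKa
  have haa := mem_adjoin_simple_self K a
  have hb' : b ∉ (⊥ : IntermediateField K F) := fun h => hb (bot_le (a := K⟮a⟯) h)
  obtain ⟨z, hz0, hza, hzb⟩ := meet haV hbV ha hb
  have hKK {r : F} (hra : r ∈ K⟮a⟯) (hrb : r ∈ K⟮b⟯) : r ∈ (⊥ : IntermediateField K F) := by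
    obtain ⟨s, hs, t, ht, rfl⟩ := exists_add_mul_of_mem_adjoin_simple hsq hrb
    by_cases ht0 : t = 0
    · simpa [ht0] using hs
    · exact absurd (mem_of_add_mul_mem (bot_le (a := K⟮a⟯) hs) (bot_le (a := K⟮a⟯) ht) ht0 hra) hb
  refine ⟨z, hz0, fun c hc => ?_⟩
  by_cases hca : c ∈ K⟮a⟯
  · exact (mem_stab.1 (adjoin_simple_mul_mem hsq hca hza)).1
  by_cases hcb : c ∈ K⟮b⟯
  · exact (mem_stab.1 (adjoin_simple_mul_mem hsq hcb hzb)).1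
  have hc' : c ∉ (⊥ : IntermediateField K F) := fun h => hca (bot_le (a := K⟮a⟯) h)
  by_cases hcM : c ∈ K⟮b, a⟯
  · obtain ⟨α, hα, β, hβ, rfl⟩ := exists_add_mul_of_mem_adjoin_insert hsq hcM
    by_cases hβ' : β ∈ (⊥ : IntermediateField K F)
    · rw [show (α + b * β) * z = α * z + β * (b * z) by ring]
      exact W.add_mem (mem_stab.1 (adjoin_simple_mul_mem hsq hα hza)).1
        (bot_mul_mem hβ' (mem_stab.1 hzb).2)
    exfalso
    obtain ⟨s, hs, t, ht, rfl⟩ := exists_add_mul_of_mem_adjoin_simple hsq hβ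
    obtain ⟨s', hs', t', ht', rfl⟩ := exists_add_mul_of_mem_adjoin_simple hsq hα
    have ht0 : t ≠ 0 := fun h => hβ' (by simpa [h] using hs)
    have habV : a * b ∈ V := by
      have h2 : s' * 1 + t' * a + s * b ∈ V := V.add_mem (V.add_mem (bot_mul_mem hs' h1)
        (bot_mul_mem ht' haV)) (bot_mul_mem hs hbV)
      have h3 := bot_mul_mem (inv_mem ht) (V.sub_mem hc h2)
      rwa [show t⁻¹ * (s' + a * t' + b * (s + a * t) - (s' * 1 + t' * a + s * b)) = a * b by
        field_simp; ring] at h3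
    have := four_le_finrank_stab hsq ha one_ne_zero (mem_stab.2 ⟨h1, by simpa using haV⟩)
      (mem_stab.2 ⟨hbV, habV⟩) (fun r hr h => hb (by rwa [h, mul_one]))
    have := hV a ha
    omega
  obtain ⟨x, hx0, hxa, hxc⟩ := meet haV hc ha hca
  obtain ⟨y, hy0, hyb, hyc⟩ := meet hbV hc hb' hcb
  obtain ⟨α, hα, rfl⟩ := exists_mul_of_mem_stab hsq ha (hW a ha) hz0 hza hxa
  obtain ⟨β, hβ, rfl⟩ := exists_mul_of_mem_stab hsq hb' (hW b hb') hz0 hzb hyb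
  obtain ⟨γ, hγ, hγe⟩ := exists_mul_of_mem_stab hsq hc' (hW c hc') hx0 hxc hyc
  have hα0 : α ≠ 0 := left_ne_zero_of_mul hx0
  have hβ0 : β ≠ 0 := left_ne_zero_of_mul hy0
  have hβγ : β = γ * α := mul_right_cancel₀ hz0 (by rw [hγe]; ring)
  have haM : K⟮a⟯ ≤ K⟮b, a⟯ := adjoin.mono K _ _ (by simp)
  have hbM : K⟮b⟯ ≤ K⟮b, a⟯ := adjoin.mono K _ _ (by simp)
  have hγM : γ ∈ K⟮b, a⟯ := by
    rw [show γ = β / α by rw [hβγ]; field_simp]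
    exact div_mem (hbM hβ) (haM hα)
  obtain ⟨s, hs, t, ht, rfl⟩ := exists_add_mul_of_mem_adjoin_simple hsq hγ
  have ht0 : t = 0 := by
    by_contra ht0
    exact hcM (mem_of_add_mul_mem (bot_le (a := K⟮b, a⟯) hs) (bot_le (a := K⟮b, a⟯) ht) ht0 hγM)
  have hβK : β ∈ (⊥ : IntermediateField K F) := hKK (by
    rw [hβγ, ht0, mul_zero, add_zero]; exact mul_mem (bot_le (a := K⟮a⟯) hs) hα) hβ
  have := bot_mul_mem (inv_mem hβK) (mem_stab.1 hyc).2
  rwa [show β⁻¹ * (c * (β * z)) = c * z by field_simp] at this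

/-- The subspace `c * U`. -/
abbrev mulMap (c : F) (U : Submodule K F) : Submodule K F := U.map (LinearMap.mulLeft K c)

theorem mulLeft_injective {c : F} (hc : c ≠ 0) : Function.Injective (LinearMap.mulLeft K c) :=
  fun _ _ h => mul_left_cancel₀ hc h

theorem finrank_mulMap {c : F} (hc : c ≠ 0) (U : Submodule K F) :
    finrank K (mulMap c U) = finrank K U :=
  (Submodule.equivMapOfInjective _ (mulLeft_injective hc) U).finrank_eq.symm

theorem mem_mulMap {c : F} (hc : c ≠ 0) {U : Submodule K F} {x : F} :
    x ∈ mulMap c U ↔ c⁻¹ * x ∈ U := by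
  constructor
  · rintro ⟨y, hy, rfl⟩
    simpa [hc] using hy
  · intro h
    exact ⟨_, h, by simp [hc]⟩

theorem stab_mulMap {c : F} (hc : c ≠ 0) (U : Submodule K F) (d : F) :
    stab (mulMap c U) d = mulMap c (stab U d) := by
  ext x
  rw [mem_stab, mem_mulMap hc, mem_mulMap hc, mem_mulMap hc, mem_stab, mul_left_comm]

/-- If some non-scalar stabilises a subspace of dimension at least four in `V`, then `V` contains
a multiple of a biquadratic extension. -/
theorem exists_adjoin_le (hsq : ∀ x : F, x ^ 2 ∈ (⊥ : IntermediateField K F))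
    {V : Submodule K F} [FiniteDimensional K V] {a : F}
    (ha : a ∉ (⊥ : IntermediateField K F)) (hV : 4 ≤ finrank K (stab V a)) :
    ∃ v, v ≠ 0 ∧ ∃ M : IntermediateField K F, 4 ≤ finrank K M ∧ ∀ m ∈ M, m * v ∈ V := by
  have haa := mem_adjoin_simple_self K a
  obtain ⟨v, hv0, hv⟩ := exists_mem_of_stab_ne_bot (V := V) (d := a) (by
    intro h; rw [h, finrank_bot] at hV; omega)
  obtain ⟨y, hy, hyv⟩ : ∃ y ∈ stab V a, ∀ r ∈ K⟮a⟯, y ≠ r * v := by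
    by_contra! hcon
    have : FiniteDimensional K (Submodule.span K {v, a * v}) :=
      FiniteDimensional.span_of_finite K (Set.toFinite _)
    have hle : stab V a ≤ Submodule.span K {v, a * v} := by
      intro y hy
      obtain ⟨r, hr, rfl⟩ := hcon y hy
      obtain ⟨s, hs, t, ht, rfl⟩ := exists_add_mul_of_mem_adjoin_simple hsq hr
      rw [show (s + a * t) * v = s * v + t * (a * v) by ring]
      exact Submodule.add_mem _ (bot_mul_mem hs (Submodule.subset_span (by simp)))
        (bot_mul_mem ht (Submodule.subset_span (by simp)))
    have h1 := Submodule.finrank_mono hle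
    have h2 := finrank_range_le_card (R := K) ![v, a * v]
    simp only [Matrix.range_cons, Matrix.range_empty, Set.union_empty, Set.singleton_union,
      Fintype.card_fin] at h2
    exact absurd (hV.trans (h1.trans h2)) (by norm_num)
  have hM : ∀ m ∈ K⟮y / v, a⟯, m * v ∈ V := by
    intro m hm
    obtain ⟨α, hα, β, hβ, rfl⟩ := exists_add_mul_of_mem_adjoin_insert hsq hm
    rw [show (α + y / v * β) * v = α * v + β * y by field_simp]
    exact V.add_mem (mem_stab.1 (adjoin_simple_mul_mem hsq hα hv)).1
      (mem_stab.1 (adjoin_simple_mul_mem hsq hβ hy)).1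
  refine ⟨v, hv0, K⟮y / v, a⟯, ?_, hM⟩
  set U := K⟮y / v, a⟯.toSubalgebra.toSubmodule with hU
  have : FiniteDimensional K U := by
    have hle : U.map (LinearMap.mulLeft K v) ≤ V := by
      rintro _ ⟨m, hm, rfl⟩
      rw [LinearMap.mulLeft_apply, mul_comm]
      exact hM m hm
    have := Submodule.finiteDimensional_of_le hle
    exact (Submodule.equivMapOfInjective _ (mulLeft_injective hv0) U).symm.finiteDimensional
  have haM : a ∈ K⟮y / v, a⟯ := subset_adjoin K _ (by simp)
  have hbM : y / v ∈ K⟮y / v, a⟯ := subset_adjoin K _ (by simp)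
  exact four_le_finrank (U := U) ha one_ne_zero (one_mem K⟮y / v, a⟯) (by rw [mul_one]; exact haM)
    hbM (mul_mem (S := IntermediateField K F) haM hbM) (fun r hr h => hyv r hr (by rw [← mul_one r, ← h]; field_simp))

theorem le_of_finrank_stab_eq {V W : Submodule K F} [FiniteDimensional K V]
    [FiniteDimensional K W] (hdim : finrank K W ≤ 5)
    (hVW : ∀ d, finrank K (stab V d) = finrank K (stab W d)) {M M' : IntermediateField K F}
    (hM : 4 ≤ finrank K M) (hM' : 4 ≤ finrank K M')
    (hMV : M.toSubalgebra.toSubmodule ≤ V) (hMW : M'.toSubalgebra.toSubmodule ≤ W) :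
    M ≤ M' := by
  intro d hd
  by_cases hd0 : d = 0
  · exact hd0 ▸ zero_mem _
  set N := M.toSubalgebra.toSubmodule
  set N' := M'.toSubalgebra.toSubmodule
  have hN : 4 ≤ finrank K N := hM
  have hN' : 4 ≤ finrank K N' := hM'
  have : FiniteDimensional K N' := Submodule.finiteDimensional_of_le hMW
  have h1 : 4 ≤ finrank K (stab W d) := by
    rw [← hVW]
    refine hN.trans (Submodule.finrank_mono fun m hm => mem_stab.2 ⟨hMV hm, hMV ?_⟩)
    exact mul_mem (S := IntermediateField K F) hd hm
  have e1 := Submodule.finrank_sup_add_finrank_inf_eq N' (stab W d)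
  have l1 := Submodule.finrank_mono (sup_le hMW (stab_le W d))
  set S := N' ⊓ stab W d
  have hS : mulMap d S ≤ W := by
    rintro _ ⟨m, hm, rfl⟩
    exact (mem_stab.1 hm.2).2
  have e2 := Submodule.finrank_sup_add_finrank_inf_eq (mulMap d S) N'
  have l2 := Submodule.finrank_mono (sup_le hS hMW)
  rw [finrank_mulMap hd0] at e2
  obtain ⟨x, hx, hx0⟩ := Submodule.exists_mem_ne_zero_of_ne_bot
    (p := mulMap d S ⊓ N') (by intro h; rw [h, finrank_bot] at e2; omega)
  obtain ⟨⟨m, hm, rfl⟩, hdm⟩ := hx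
  have hm' : m ∈ M' := hm.1
  have hdm' : d * m ∈ M' := hdm
  have hm0 : m ≠ 0 := by rintro rfl; simp at hx0
  have := div_mem hdm' hm'
  rwa [mul_div_cancel_right₀ _ hm0] at this

theorem stab_zero (V : Submodule K F) : stab V 0 = V := by
  ext; simp [mem_stab]

theorem exists_mul_mem_of_adjoin_le (hsq : ∀ x : F, x ^ 2 ∈ (⊥ : IntermediateField K F))
    {V W : Submodule K F} [FiniteDimensional K V]
    [FiniteDimensional K W] (hdim : finrank K W ≤ 5)
    (hVW : ∀ d, finrank K (stab V d) = finrank K (stab W d)) {M M' : IntermediateField K F}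
    (hM : 4 ≤ finrank K M) (hM' : 4 ≤ finrank K M')
    (hMV : M.toSubalgebra.toSubmodule ≤ V) (hMW : M'.toSubalgebra.toSubmodule ≤ W) :
    ∃ z, z ≠ 0 ∧ ∀ c ∈ V, c * z ∈ W := by
  have hVWdim : finrank K V = finrank K W := by
    have h := hVW 0
    rwa [stab_zero, stab_zero] at h
  obtain rfl : M = M' := le_antisymm (le_of_finrank_stab_eq hdim hVW hM hM' hMV hMW)
    (le_of_finrank_stab_eq (hVWdim ▸ hdim) (fun d => (hVW d).symm) hM' hM hMW hMV)
  set N := M.toSubalgebra.toSubmodule with hNdef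
  have hN : 4 ≤ finrank K N := hM
  have memN {x : F} : x ∈ N ↔ x ∈ M := Iff.rfl
  by_cases hVN : V ≤ N
  · exact ⟨1, one_ne_zero, fun c hc => by rw [mul_one]; exact hMW (hVN hc)⟩
  obtain ⟨y, hyV, hyN⟩ := SetLike.not_le_iff_exists.1 hVN
  have hVy : V = N ⊔ Submodule.span K {y} := by
    refine (Submodule.eq_of_le_of_finrank_le (sup_le hMV (by simpa using hyV)) ?_).symm
    have : FiniteDimensional K N := Submodule.finiteDimensional_of_le hMV
    have hlt : N < N ⊔ Submodule.span K {y} := by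
      refine lt_of_le_of_ne le_sup_left fun h => hyN ?_
      rw [h]
      exact Submodule.mem_sup_right (Submodule.mem_span_singleton_self y)
    have := Submodule.finrank_lt_finrank_of_lt hlt
    omega
  have hV {x : F} (hx : x ∈ V) : ∃ m ∈ M, ∃ k ∈ (⊥ : IntermediateField K F), x = m + k * y := by
    rw [hVy] at hx
    obtain ⟨m, hm, w, hw, rfl⟩ := Submodule.mem_sup.1 hx
    obtain ⟨k, rfl⟩ := Submodule.mem_span_singleton.1 hw
    exact ⟨m, hm, _, _root_.algebraMap_mem _ k, by rw [Algebra.smul_def]⟩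
  obtain ⟨z, hzW, hzN⟩ : ∃ z ∈ W, z ∉ N := by
    by_contra! h
    have hWN : W ≤ N := h
    have : FiniteDimensional K N := Submodule.finiteDimensional_of_le hMV
    have h1 := Submodule.finrank_mono hWN
    have h2 := Submodule.finrank_lt_finrank_of_lt (lt_of_le_of_ne hMV (by
      rintro h; exact hVN h.ge))
    omega
  obtain ⟨x, hx0, hx⟩ := exists_mem_of_stab_ne_bot (V := V) (d := z) (by
    intro h
    have h1 := hVW z
    rw [h, finrank_bot] at h1
    have h2 : (1 : F) ∈ stab W z :=
      mem_stab.2 ⟨hMW (memN.2 (one_mem M)), by rwa [mul_one]⟩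
    rw [Submodule.finrank_eq_zero.1 h1.symm] at h2
    exact one_ne_zero h2)
  obtain ⟨m, hm, k, hk, hxe⟩ := hV (mem_stab.1 hx).1
  obtain ⟨m', hm', k', hk', hzx⟩ := hV (mem_stab.1 hx).2
  have hbot {r : F} (hr : r ∈ (⊥ : IntermediateField K F)) : r ∈ M := bot_le (a := M) hr
  obtain ⟨p, hp, q, hq, hz⟩ : ∃ p ∈ M, ∃ q ∈ M, z = p + q * y := by
    refine ⟨(x ^ 2)⁻¹ * (m * m' + k * k' * y ^ 2), ?_, (x ^ 2)⁻¹ * (m * k' + m' * k), ?_, ?_⟩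
    · exact mul_mem (hbot (inv_mem (hsq x))) (add_mem (mul_mem hm hm')
        (mul_mem (hbot (mul_mem hk hk')) (hbot (hsq y))))
    · exact mul_mem (hbot (inv_mem (hsq x))) (add_mem (mul_mem hm (hbot hk'))
        (mul_mem hm' (hbot hk)))
    · have : z = (x ^ 2)⁻¹ * (x * (z * x)) := by field_simp
      rw [this, hzx]
      nth_rewrite 2 [hxe]
      ring
  have hq0 : q ≠ 0 := by
    rintro rfl
    exact hzN (by rw [hz, zero_mul, add_zero]; exact hp)
  refine ⟨q, hq0, fun c hc => ?_⟩
  obtain ⟨n, hn, l, hl, rfl⟩ := hV hc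
  rw [show (n + l * y) * q = (n * q - l * p) + l * z by rw [hz]; ring]
  exact W.add_mem (hMW (memN.2 (sub_mem (mul_mem hn hq) (mul_mem (hbot hl) hp))))
    (bot_mul_mem hl hzW)

/-- Two subspaces of dimension at most five which are stabilised in equal dimensions by every
element are multiples of each other. -/
theorem exists_mul_mem (hsq : ∀ x : F, x ^ 2 ∈ (⊥ : IntermediateField K F))
    {V W : Submodule K F} [FiniteDimensional K V] [FiniteDimensional K W]
    (hdim : finrank K W ≤ 5) (hVW : ∀ d, finrank K (stab V d) = finrank K (stab W d)) :
    ∃ z, z ≠ 0 ∧ ∀ c ∈ V, c * z ∈ W := by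
  by_cases hV : ∀ d ∉ (⊥ : IntermediateField K F), finrank K (stab V d) ≤ 3
  · by_cases hbot : V = ⊥
    · exact ⟨1, one_ne_zero, by simp [hbot]⟩
    obtain ⟨v, hv, hv0⟩ := Submodule.exists_mem_ne_zero_of_ne_bot hbot
    have hvi := inv_ne_zero hv0
    have hV' (d : F) : finrank K (stab (mulMap v⁻¹ V) d) = finrank K (stab V d) := by
      rw [stab_mulMap hvi, finrank_mulMap hvi]
    obtain ⟨z, hz0, hz⟩ := exists_mul_mem_of_finrank_stab_le hsq (V := mulMap v⁻¹ V) hdim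
      (fun d hd => hV' d ▸ hV d hd) (fun d hd => hVW d ▸ hV d hd)
      ((mem_mulMap hvi).2 (by simpa using hv)) (fun d h h' => h (by
        rw [← Submodule.finrank_eq_zero, hV', hVW, h', finrank_bot]))
    refine ⟨v⁻¹ * z, mul_ne_zero hvi hz0, fun c hc => ?_⟩
    rw [← mul_assoc, mul_comm c]
    exact hz _ ⟨c, hc, rfl⟩
  push Not at hV
  obtain ⟨a, ha, ha4⟩ := hV
  obtain ⟨v, hv0, M, hM, hMV⟩ := exists_adjoin_le hsq ha ha4
  obtain ⟨w, hw0, M', hM', hMW⟩ := exists_adjoin_le hsq ha (hVW a ▸ ha4)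
  have hvi := inv_ne_zero hv0
  have hwi := inv_ne_zero hw0
  obtain ⟨z, hz0, hz⟩ := exists_mul_mem_of_adjoin_le hsq (V := mulMap v⁻¹ V)
    (W := mulMap w⁻¹ W) (by rwa [finrank_mulMap hwi])
    (fun d => by rw [stab_mulMap hvi, finrank_mulMap hvi, stab_mulMap hwi, finrank_mulMap hwi, hVW])
    hM hM' (fun m hm => (mem_mulMap hvi).2 (by rw [inv_inv, mul_comm]; exact hMV m hm))
    (fun m hm => (mem_mulMap hwi).2 (by rw [inv_inv, mul_comm]; exact hMW m hm))
  refine ⟨w * (v⁻¹ * z), mul_ne_zero hw0 (mul_ne_zero hvi hz0), fun c hc => ?_⟩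
  have := (mem_mulMap hwi).1 (hz _ ⟨c, hc, rfl⟩)
  rwa [inv_inv, LinearMap.mulLeft_apply,
    show w * (v⁻¹ * c * z) = c * (w * (v⁻¹ * z)) by ring] at this

end Stab
end SquareStab

namespace QLF

section Frobenius

open SquareStab

variable {F : Type u} [Field F] [CharP F 2]

/-- The subfield of squares, as the image of Frobenius. -/
abbrev squares (F : Type u) [Field F] [CharP F 2] : Subfield F := (frobenius F 2).fieldRange

theorem sq_mem_bot (x : F) : x ^ 2 ∈ (⊥ : IntermediateField (squares F) F) :=
  IntermediateField.mem_bot.2 ⟨⟨x ^ 2, x, rfl⟩, rfl⟩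

/-- Squaring, as a map into an intermediate field between `F²` and `F`. -/
def sqHom (L : IntermediateField (squares F) F) : F →+* L :=
  (frobenius F 2).codRestrict L fun x => bot_le (a := L) (sq_mem_bot x)

theorem defect_sqHom_add_finrank (L : IntermediateField (squares F) F) [CharP L 2]
    {n : ℕ} (a : Fin n → F) :
    defect 2 (sqHom L ∘ a) + Module.finrank L (Submodule.span L (Set.range a)) = n := by
  have hker : zeroSubmodule 2 (sqHom L ∘ a) = LinearMap.ker (Fintype.linearCombination L a) := by
    ext x
    change eval 2 (sqHom L ∘ a) x = 0 ↔ _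
    have hx : ((eval 2 (sqHom L ∘ a) x : L) : F) = Fintype.linearCombination L a x ^ 2 := by
      rw [Fintype.linearCombination_apply, sum_pow_char, eval, AddSubmonoidClass.coe_finsetSum]
      exact Finset.sum_congr rfl fun i _ => by
        rw [Algebra.smul_def, mul_pow, mul_comm]
        rfl
    rw [LinearMap.mem_ker, ← ZeroMemClass.coe_eq_zero, hx, pow_eq_zero_iff two_ne_zero]
  have := LinearMap.finrank_range_add_finrank_ker (Fintype.linearCombination L a)
  rw [Fintype.range_linearCombination, ← hker, Module.finrank_fin_fun] at this
  rwa [add_comm]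

theorem VishikEquiv.finrank_span_eq {n : ℕ} {φ ψ : Fin n → F} (h : VishikEquiv 2 φ ψ)
    (L : IntermediateField (squares F) F) :
    Module.finrank L (Submodule.span L (Set.range φ)) =
      Module.finrank L (Submodule.span L (Set.range ψ)) := by
  have := charP_of_injective_algebraMap (algebraMap L F).injective 2
  have h1 := defect_sqHom_add_finrank L φ
  have h2 := defect_sqHom_add_finrank L ψ
  rw [h.2 L (sqHom L)] at h1
  omega

/-- The value set of a form, as a subspace over the field of squares. -/
abbrev valueSpace {n : ℕ} (a : Fin n → F) : Submodule (squares F) F :=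
  Submodule.span (squares F) (Set.range a)

instance {n : ℕ} (a : Fin n → F) : FiniteDimensional (squares F) (valueSpace a) :=
  FiniteDimensional.span_of_finite _ (Set.finite_range a)

theorem span_adjoin_simple_eq_sup {n : ℕ} (a : Fin n → F) (d : F) :
    (Submodule.span (IntermediateField.adjoin (squares F) {d}) (Set.range a)).restrictScalars
      (squares F) = valueSpace a ⊔ mulMap d (valueSpace a) := by
  set L := IntermediateField.adjoin (squares F) {d}
  set V := valueSpace a
  apply le_antisymm
  · intro x hx
    induction hx using Submodule.span_induction with
    | mem x hx => exact Submodule.mem_sup_left (Submodule.subset_span hx)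
    | zero => exact zero_mem _
    | add x y _ _ hx hy => exact add_mem hx hy
    | smul r x _ hx =>
      obtain ⟨v, hv, _, ⟨w, hw, rfl⟩, rfl⟩ := Submodule.mem_sup.1 hx
      obtain ⟨s, hs, t, ht, hr⟩ := exists_add_mul_of_mem_adjoin_simple sq_mem_bot r.2
      rw [Algebra.smul_def, show algebraMap L F r = r from rfl, hr, LinearMap.mulLeft_apply,
        show (s + d * t) * (v + d * w) = s * v + t * (d ^ 2 * w) + d * (t * v + s * w) by ring]
      exact add_mem (Submodule.mem_sup_left (add_mem (bot_mul_mem hs hv)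
        (bot_mul_mem ht (bot_mul_mem (sq_mem_bot d) hw)))) (Submodule.mem_sup_right
        ⟨_, add_mem (bot_mul_mem ht hv) (bot_mul_mem hs hw), rfl⟩)
  · have hV : V ≤ (Submodule.span L (Set.range a)).restrictScalars (squares F) :=
      Submodule.span_le.2 Submodule.subset_span
    refine sup_le hV ?_
    rintro _ ⟨v, hv, rfl⟩
    exact Submodule.smul_mem _
      (⟨d, IntermediateField.mem_adjoin_simple_self _ d⟩ : L) (hV hv)

theorem VishikEquiv.finrank_sup_eq {n : ℕ} {φ ψ : Fin n → F} (h : VishikEquiv 2 φ ψ) (d : F) :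
    Module.finrank (squares F) ↥(valueSpace φ ⊔ mulMap d (valueSpace φ)) =
      Module.finrank (squares F) ↥(valueSpace ψ ⊔ mulMap d (valueSpace ψ)) := by
  rw [← span_adjoin_simple_eq_sup, ← span_adjoin_simple_eq_sup]
  set L := IntermediateField.adjoin (squares F) {d}
  have h1 := Module.finrank_mul_finrank (squares F) L (Submodule.span L (Set.range φ))
  have h2 := Module.finrank_mul_finrank (squares F) L (Submodule.span L (Set.range ψ))
  rw [h.finrank_span_eq L] at h1
  exact h1.symm.trans h2

theorem finrank_sup_add_finrank_stab (V : Submodule (squares F) F)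
    [FiniteDimensional (squares F) V] {d : F} (hd : d ≠ 0) :
    Module.finrank (squares F) ↥(V ⊔ mulMap d V) + Module.finrank (squares F) (stab V d) =
      Module.finrank (squares F) V + Module.finrank (squares F) V := by
  have h1 := Submodule.finrank_sup_add_finrank_inf_eq V (mulMap d V)
  have h2 : V ⊓ mulMap d V = mulMap d (stab V d) := by
    ext x
    rw [Submodule.mem_inf, mem_mulMap hd, mem_mulMap hd, mem_stab, mul_inv_cancel_left₀ hd,
      and_comm]
  rwa [h2, finrank_mulMap hd, finrank_mulMap hd] at h1

theorem VishikEquiv.finrank_stab_eq {n : ℕ} {φ ψ : Fin n → F} (h : VishikEquiv 2 φ ψ) (d : F) :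
    Module.finrank (squares F) (stab (valueSpace φ) d) =
      Module.finrank (squares F) (stab (valueSpace ψ) d) := by
  have h0 : Module.finrank (squares F) (valueSpace φ) =
      Module.finrank (squares F) (valueSpace ψ) := by
    have hle (V : Submodule (squares F) F) : mulMap 0 V ≤ V := by
      rintro _ ⟨v, -, rfl⟩
      simp
    have := h.finrank_sup_eq 0
    rwa [sup_of_le_left (hle _), sup_of_le_left (hle _)] at this
  by_cases hd : d = 0
  · rwa [hd, stab_zero, stab_zero]
  have h1 := finrank_sup_add_finrank_stab (valueSpace φ) hd
  have h2 := finrank_sup_add_finrank_stab (valueSpace ψ) hd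
  rw [h.finrank_sup_eq d, h0] at h1
  omega

theorem exists_equiv_range_prod_ker {k X Y : Type*} [Field k] [AddCommGroup X] [Module k X]
    [AddCommGroup Y] [Module k Y] (A : X →ₗ[k] Y) :
    ∃ e : X ≃ₗ[k] LinearMap.range A × LinearMap.ker A, ∀ x, ((e x).1 : Y) = A x := by
  obtain ⟨g, hg⟩ := (LinearMap.ker A).subtype.exists_leftInverse_of_injective
    (Submodule.ker_subtype _)
  have hg' (x : LinearMap.ker A) : g x = x := LinearMap.congr_fun hg x
  refine ⟨LinearMap.equivProdOfSurjectiveOfIsCompl A.rangeRestrict g A.range_rangeRestrict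
    (LinearMap.range_eq_top.2 fun x => ⟨x, hg' x⟩) ?_, fun x => rfl⟩
  rw [LinearMap.ker_rangeRestrict]
  exact LinearMap.isCompl_of_proj hg'

theorem exists_equiv_comp_eq {k X X' Y : Type*} [Field k] [AddCommGroup X] [Module k X]
    [AddCommGroup X'] [Module k X'] [AddCommGroup Y] [Module k Y] [FiniteDimensional k X]
    [FiniteDimensional k X'] {A : X →ₗ[k] Y} {B : X' →ₗ[k] Y}
    (hX : Module.finrank k X = Module.finrank k X')
    (hAB : LinearMap.range A = LinearMap.range B) :
    ∃ τ : X ≃ₗ[k] X', ∀ x, A x = B (τ x) := by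
  obtain ⟨e, he⟩ := exists_equiv_range_prod_ker A
  obtain ⟨e', he'⟩ := exists_equiv_range_prod_ker B
  have hker : Module.finrank k (LinearMap.ker A) = Module.finrank k (LinearMap.ker B) := by
    have h1 := A.finrank_range_add_finrank_ker
    have h2 := B.finrank_range_add_finrank_ker
    rw [hAB] at h1
    omega
  refine ⟨e ≪≫ₗ (LinearEquiv.prodCongr (LinearEquiv.ofEq _ _ hAB)
    (LinearEquiv.ofFinrankEq _ _ hker)) ≪≫ₗ e'.symm, fun x => ?_⟩
  rw [← he', ← he]
  simp

/-- Forms of the same dimension with the same values are isometric. -/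
theorem isometric_of_valueSpace_eq {n : ℕ} {a b : Fin n → F} (h : valueSpace a = valueSpace b) :
    Isometric 2 a b := by
  obtain ⟨τ, hτ⟩ := exists_equiv_comp_eq (A := Fintype.linearCombination (squares F) a)
    (B := Fintype.linearCombination (squares F) b) rfl (by
      rwa [Fintype.range_linearCombination, Fintype.range_linearCombination])
  let σ : F ≃+* squares F := (frobenius F 2).rangeRestrictFieldEquiv
  have hσ (x : F) : (σ x : F) = x ^ 2 := rfl
  have heval (a x : Fin n → F) :
      eval 2 a x = Fintype.linearCombination (squares F) a fun i => σ (x i) := by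
    rw [Fintype.linearCombination_apply, eval]
    exact Finset.sum_congr rfl fun i _ => by rw [Subfield.smul_def, hσ, smul_eq_mul, mul_comm]
  let T : (Fin n → F) ≃ₗ[F] (Fin n → F) :=
    { toFun := fun x i => σ.symm (τ (fun j => σ (x j)) i)
      invFun := fun x i => σ.symm (τ.symm (fun j => σ (x j)) i)
      map_add' := fun x y => by
        ext i
        have : (fun j => σ ((x + y) j)) = (fun j => σ (x j)) + fun j => σ (y j) := by
          ext j; simp
        change σ.symm (τ (fun j => σ ((x + y) j)) i) = _
        rw [this, map_add, Pi.add_apply, map_add]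
        rfl
      map_smul' := fun c x => by
        ext i
        have : (fun j => σ ((c • x) j)) = σ c • fun j => σ (x j) := by
          ext j; simp
        change σ.symm (τ (fun j => σ ((c • x) j)) i) = _
        rw [this, map_smul, Pi.smul_apply, smul_eq_mul, map_mul, RingEquiv.symm_apply_apply]
        rfl
      left_inv := fun x => by simp
      right_inv := fun x => by simp }
  refine ⟨T, fun x => ?_⟩
  rw [heval, heval, hτ]
  congr 1
  ext i
  simp [T]

theorem VishikEquiv.similar {n : ℕ} (hn : n ≤ 5) {φ ψ : Fin n → F} (h : VishikEquiv 2 φ ψ) :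
    Similar 2 φ ψ := by
  have hdim : Module.finrank (squares F) (valueSpace ψ) ≤ 5 :=
    (finrank_range_le_card ψ).trans (by simpa using hn)
  obtain ⟨z, hz0, hz⟩ := exists_mul_mem sq_mem_bot hdim h.finrank_stab_eq
  have hVW : mulMap z (valueSpace φ) = valueSpace ψ := by
    refine Submodule.eq_of_le_of_finrank_eq ?_ ?_
    · rintro _ ⟨c, hc, rfl⟩
      rw [LinearMap.mulLeft_apply, mul_comm]
      exact hz c hc
    · rw [finrank_mulMap hz0]
      have h0 := h.finrank_stab_eq 0
      rwa [stab_zero, stab_zero] at h0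
  refine ⟨z⁻¹, inv_ne_zero hz0, isometric_of_valueSpace_eq ?_⟩
  have hψ : valueSpace (fun i => z⁻¹ * ψ i) = mulMap z⁻¹ (valueSpace ψ) := by
    rw [mulMap, Submodule.map_span, ← Set.range_comp]
    rfl
  rw [hψ, ← hVW]
  ext x
  rw [mem_mulMap (inv_ne_zero hz0), mem_mulMap hz0]
  simp [hz0]

end Frobenius

end QLF

/-- Over a field of characteristic 2, Vishik equivalent totally
singular quadratic forms of dimension at most 5 are similar. -/
theorem stmt_7 {F : Type u} [Field F] [CharP F 2]
    {n m : ℕ} (hn : n ≤ 5) (hm : m ≤ 5)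
    (φ : Fin n → F) (ψ : Fin m → F)
    (h : QLF.VishikEquiv 2 φ ψ) :
    QLF.Similar 2 φ ψ := by
  obtain rfl : n = m := by simpa using h.1
  exact h.similar hn
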